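/- Let d ≥ 1 and let 1 ≤ p₀, p₁, p₂, q₁, q₂, q₃, r₀, r₁, r₂, s₁, s₂, s₃ ≤ ∞. Suppose there exist auxiliary exponents p̃₁, p̃₂, q̃₁, q̃₂ ∈ [1,∞] with p₁ ≤ p̃₁ ≤ r₁, p₂ ≤ p̃₂ ≤ r₂, q₁ ≤ q̃₁, s₁ ≤ q̃₁, q₂ ≤ q̃₂, s₂ ≤ q̃₂, satisfying: 1/p̃₁ ≤ 1/r₀; 1/p̃₁ − 1/r₁ ≤ 1/r₀ − 1/p̃₂; (1/p̃₁ − 1/r₁) + (1/p̃₂ − 1/r₂) ≥ 1/r₀ − 1/p₀; 1/s₃ ≤ 1/q̃₂; 1/q̃₂ − 1/s₂ ≥ 1/s₃ − 1/q̃₁; (1/q̃₁ − 1/s₁) + (1/q̃₂ − 1/s₂) ≥ 1/s₃ − 1/q₃. Then there is a constant C > 0 depending only on d and the exponents such that for all Schwartz functions f₁, f₂, g on ℝ^d, the function H(x, t₁, t₂, ξ₁, ξ₂, ν) = |V_{φ₀} f₁(x−t₁, ξ₁)| · |V_{φ₀} f₂(x−t₂, ξ₂)| · |V_{φ₀} g(x,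 ν + ξ₁ + ξ₂)|, with φ₀ the Gaussian window, satisfies the iterated mixed-norm bound (taking the L^{r₀} norm in x, then L^{r₁} in t₁, L^{r₂} in t₂, then L^{s₁} in ξ₁, L^{s₂} in ξ₂, and finally L^{s₃} in ν, essential suprema for infinite exponents): ‖H‖ ≤ C · ‖f₁‖_{M^{p₁,q₁}} · ‖f₂‖_{M^{p₂,q₂}} · ‖g‖_{M^{p₀,q₃}}. -/

import Mathlib

open MeasureTheory Complex
open scoped ENNReal NNReal RealInnerProductSpace

noncomputable section

abbrev Ed (d : ℕ) := EuclideanSpace ℝ (Fin d)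

/-- `e2pi a = e^{2πi a}`. -/
def e2pi (a : ℝ) : ℂ := Complex.exp (2 * Real.pi * Complex.I * (a : ℂ))

/-- Short-time Fourier transform `V_φ f (t, ν)`. -/
def STFT (d : ℕ) (φ f : Ed d → ℂ) (t ν : Ed d) : ℂ :=
  ∫ y, f y * e2pi (-⟪y, ν⟫) * φ (y - t)

/-- The Gaussian window `e^{-‖x‖²}` as a complex-valued function. -/
def gauss (d : ℕ) : Ed d → ℂ := fun x => (Real.exp (-‖x‖ ^ 2) : ℝ)

/-- `L^p`-type norm (`ℝ≥0∞`-valued) with essential supremum in case `p = ∞`. -/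
def eNorm {α : Type*} [MeasurableSpace α] (μ : Measure α) (p : ℝ≥0∞) (F : α → ℝ≥0∞) : ℝ≥0∞ :=
  if p = ∞ then essSup F μ else (∫⁻ a, F a ^ p.toReal ∂μ) ^ (1 / p.toReal)

/-- Modulation space norm `‖f‖_{M^{p,q}}` with the Gaussian window. -/
def modNorm (d : ℕ) (p q : ℝ≥0∞) (f : Ed d → ℂ) : ℝ≥0∞ :=
  eNorm volume q fun ν => eNorm volume p fun t => (‖STFT d (gauss d) f t ν‖₊ : ℝ≥0∞)

/-- The Gaussian window on `ℝ^{3d}`. -/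
def gauss3 (d : ℕ) : Ed d × Ed d × Ed d → ℂ :=
  fun X => (Real.exp (-‖X.1‖ ^ 2 - ‖X.2.1‖ ^ 2 - ‖X.2.2‖ ^ 2) : ℝ)

/-- Symbol short-time Fourier transform of a symbol on `ℝ^{3d}`. -/
def symbSTFT (d : ℕ) (Φ σ : Ed d × Ed d × Ed d → ℂ) (x t₁ t₂ ξ₁ ξ₂ ν : Ed d) : ℂ :=
  ∫ X : Ed d × Ed d × Ed d,
    σ X * Φ (X.1 - x, X.2.1 - ξ₁, X.2.2 - ξ₂) *
      e2pi (-(⟪X.1, ν⟫ - ⟪t₁, X.2.1⟫ - ⟪t₂, X.2.2⟫))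

/-- Fourier transform. -/
def FT (d : ℕ) (f : Ed d → ℂ) (ξ : Ed d) : ℂ := ∫ y, f y * e2pi (-⟪y, ξ⟫)

/-- Bilinear pseudodifferential operator `T_σ`. -/
def biOp (d : ℕ) (σ : Ed d × Ed d × Ed d → ℂ) (f₁ f₂ : Ed d → ℂ) (x : Ed d) : ℂ :=
  ∫ ξ : Ed d × Ed d,
    e2pi ⟪x, ξ.1 + ξ.2⟫ * σ (x, ξ.1, ξ.2) * FT d f₁ ξ.1 * FT d f₂ ξ.2


/-- Real-valued reciprocal `1/p` of an exponent `p ∈ [1,∞]` (with `1/∞ = 0`). -/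
def iv (p : ℝ≥0∞) : ℝ := (1 / p).toReal

section MixedNorms

variable {α : Type*} [MeasurableSpace α] {μ : Measure α} {p q : ℝ≥0∞} {F G : α → ℝ≥0∞}

lemma iv_eq (p : ℝ≥0∞) : iv p = 1 / p.toReal := by simp [iv]

lemma iv_nonneg (p : ℝ≥0∞) : 0 ≤ iv p := ENNReal.toReal_nonneg

lemma iv_top : iv ∞ = 0 := by simp [iv]

lemma toReal_exponent_pos (hp : 1 ≤ p) (h : p ≠ ∞) : 0 < p.toReal :=
  ENNReal.toReal_pos (one_pos.trans_le hp).ne' h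

lemma iv_pos (hp : 1 ≤ p) (h : p ≠ ∞) : 0 < iv p := by
  have := toReal_exponent_pos hp h
  rw [iv_eq]
  positivity

lemma ne_top_of_iv_pos (h : 0 < iv p) : p ≠ ∞ := by
  rintro rfl
  simp [iv_top] at h

lemma iv_le_iv_iff (hp : 1 ≤ p) (hq : 1 ≤ q) : iv p ≤ iv q ↔ q ≤ p := by
  have hp0 : p ≠ 0 := (one_pos.trans_le hp).ne'
  have hq0 : q ≠ 0 := (one_pos.trans_le hq).ne'
  unfold iv
  rw [ENNReal.toReal_le_toReal (by simp [hp0]) (by simp [hq0])]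
  simp

lemma iv_le_one (hp : 1 ≤ p) : iv p ≤ 1 := by
  have : iv 1 = 1 := by simp [iv]
  rw [← this]
  exact (iv_le_iv_iff hp le_rfl).2 hp

lemma exists_exponent {a : ℝ} (h0 : 0 ≤ a) (h1 : a ≤ 1) : ∃ p : ℝ≥0∞, 1 ≤ p ∧ iv p = a := by
  refine ⟨(ENNReal.ofReal a)⁻¹, ?_, ?_⟩
  · rw [ENNReal.one_le_inv]
    exact ENNReal.ofReal_le_one.2 h1
  · simp [iv, ENNReal.toReal_ofReal h0]

lemma eNorm_top : eNorm μ ∞ F = essSup F μ := by simp [eNorm]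

lemma eNorm_of_ne_top (h : p ≠ ∞) :
    eNorm μ p F = (∫⁻ a, F a ^ p.toReal ∂μ) ^ (1 / p.toReal) := by simp [eNorm, h]

lemma eNorm_one : eNorm μ 1 F = ∫⁻ a, F a ∂μ := by simp [eNorm]

lemma eNorm_rpow_toReal (hp : 1 ≤ p) (h : p ≠ ∞) :
    eNorm μ p F ^ p.toReal = ∫⁻ a, F a ^ p.toReal ∂μ := by
  have := toReal_exponent_pos hp h
  rw [eNorm_of_ne_top h, ← ENNReal.rpow_mul, one_div_mul_cancel this.ne', ENNReal.rpow_one]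

lemma eNorm_mono_ae (h : F ≤ᵐ[μ] G) : eNorm μ p F ≤ eNorm μ p G := by
  unfold eNorm
  split_ifs
  · exact essSup_mono_ae h
  · refine ENNReal.rpow_le_rpow (lintegral_mono_ae ?_) (by positivity)
    filter_upwards [h] with a ha
    exact ENNReal.rpow_le_rpow ha ENNReal.toReal_nonneg

lemma eNorm_mono (h : ∀ a, F a ≤ G a) : eNorm μ p F ≤ eNorm μ p G :=
  eNorm_mono_ae (ae_of_all _ h)

lemma eNorm_const_mul (hp : 1 ≤ p) (c : ℝ≥0∞) (hF : Measurable F) :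
    eNorm μ p (fun a => c * F a) = c * eNorm μ p F := by
  by_cases h : p = ∞
  · subst h
    simp only [eNorm_top, ENNReal.essSup_const_mul]
  · have hp0 := toReal_exponent_pos hp h
    simp only [eNorm_of_ne_top h, ENNReal.mul_rpow_of_nonneg _ _ hp0.le]
    rw [lintegral_const_mul _ (hF.pow_const _), ENNReal.mul_rpow_of_nonneg _ _ (by positivity),
      ← ENNReal.rpow_mul, mul_one_div_cancel hp0.ne', ENNReal.rpow_one]

lemma eNorm_comp {β : Type*} [MeasurableSpace β] {ν : Measure β} {T : α → β}
    (hT : MeasurePreserving T μ ν) {H : β → ℝ≥0∞} (hH : Measurable H) :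
    eNorm μ p (fun a => H (T a)) = eNorm ν p H := by
  by_cases h : p = ∞
  · subst h
    rw [eNorm_top, eNorm_top, ← hT.map_eq,
      essSup_map_measure hH.aemeasurable hT.measurable.aemeasurable]
    rfl
  · rw [eNorm_of_ne_top h, eNorm_of_ne_top h, hT.lintegral_comp (hH.pow_const _)]

/-- **Hölder's inequality** for `eNorm`. -/
lemma eNorm_mul_le {s : ℝ≥0∞} (hs : 1 ≤ s) (hp : 1 ≤ p) (hq : 1 ≤ q)
    (h : iv s = iv p + iv q) (hF : Measurable F) (hG : Measurable G) :
    eNorm μ s (fun a => F a * G a) ≤ eNorm μ p F * eNorm μ q G := by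
  by_cases hpt : p = ∞
  · have hsq : s = q := le_antisymm ((iv_le_iv_iff hq hs).1 (by linarith [iv_nonneg p]))
      ((iv_le_iv_iff hs hq).1 (by rw [h, hpt, iv_top, zero_add]))
    subst hsq hpt
    rw [eNorm_top, ← eNorm_const_mul hs _ hG]
    refine eNorm_mono_ae ?_
    filter_upwards [ENNReal.ae_le_essSup F] with a ha
    gcongr
  by_cases hqt : q = ∞
  · have hsp : s = p := le_antisymm ((iv_le_iv_iff hp hs).1 (by linarith [iv_nonneg q]))
      ((iv_le_iv_iff hs hp).1 (by rw [h, hqt, iv_top, add_zero]))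
    subst hsp hqt
    rw [eNorm_top, mul_comm, ← eNorm_const_mul hs _ hF]
    refine eNorm_mono_ae ?_
    filter_upwards [ENNReal.ae_le_essSup G] with a ha
    rw [mul_comm]
    gcongr
  have hst : s ≠ ∞ := ne_top_of_iv_pos (by linarith [iv_pos hp hpt, iv_nonneg q])
  have hs0 := toReal_exponent_pos hs hst
  have hp0 := toReal_exponent_pos hp hpt
  have hq0 := toReal_exponent_pos hq hqt
  rw [iv_eq, iv_eq, iv_eq] at h
  have key := ENNReal.lintegral_mul_norm_pow_le (μ := μ) (hF.pow_const p.toReal).aemeasurable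
    (hG.pow_const q.toReal).aemeasurable (p := s.toReal / p.toReal) (q := s.toReal / q.toReal)
    (by positivity) (by positivity)
    (by field_simp at h ⊢; linarith)
  rw [eNorm_of_ne_top hst, eNorm_of_ne_top hpt, eNorm_of_ne_top hqt]
  have hexp : ∀ x : ℝ, 0 < x → x * (s.toReal / x) = s.toReal := fun x hx => by field_simp
  simp only [← ENNReal.rpow_mul, hexp _ hp0, hexp _ hq0] at key
  simp only [ENNReal.mul_rpow_of_nonneg _ _ hs0.le]
  refine (ENNReal.rpow_le_rpow key (by positivity)).trans_eq ?_
  rw [ENNReal.mul_rpow_of_nonneg _ _ (by positivity), ← ENNReal.rpow_mul, ← ENNReal.rpow_mul]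
  congr 2 <;> field_simp

/-- **Minkowski's integral inequality** for `eNorm`, with measurable bounds on the slices. -/
lemma eNorm_lintegral_le {β : Type*} [MeasurableSpace β] {ν : Measure β} [SigmaFinite μ]
    [SFinite ν] (hp : 1 ≤ p) {f : α → β → ℝ≥0∞} (hf : Measurable (Function.uncurry f))
    {B : β → ℝ≥0∞} (hB : Measurable B) (h : ∀ y, eNorm μ p (fun x => f x y) ≤ B y) :
    eNorm μ p (fun x => ∫⁻ y, f x y ∂ν) ≤ ∫⁻ y, B y ∂ν := by
  by_cases hpt : p = ∞
  · subst hpt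
    rw [eNorm_top]
    refine essSup_le_of_ae_le _ ?_
    have hae : ∀ᵐ x ∂μ, ∀ᵐ y ∂ν, f x y ≤ B y := by
      refine (Measure.ae_ae_comm (p := fun x y => f x y ≤ B y)
        (measurableSet_le hf (hB.comp measurable_snd))).2 (ae_of_all _ fun y => ?_)
      filter_upwards [ENNReal.ae_le_essSup (μ := μ) (fun x => f x y)] with x hx
      exact hx.trans (by simpa [eNorm_top] using h y)
    filter_upwards [hae] with x hx
    exact lintegral_mono_ae hx
  have hp0 := toReal_exponent_pos hp hpt
  have hp1 : 1 ≤ p.toReal := by simpa using ENNReal.toReal_mono hpt hp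
  rcases hp1.eq_or_lt with hp1 | hp1
  · have : p = 1 := by
      rw [← ENNReal.ofReal_toReal hpt, ← hp1, ENNReal.ofReal_one]
    subst this
    simp only [eNorm_one] at h ⊢
    rw [lintegral_lintegral_swap hf.aemeasurable]
    exact lintegral_mono h
  set S : α → ℝ≥0∞ := fun x => ∫⁻ y, f x y ∂ν
  have hSm : Measurable S := hf.lintegral_prod_right'
  set t := p.toReal
  have hconj : (Real.conjExponent t).HolderConjugate t := (Real.HolderConjugate.conjExponent hp1).symm
  have bound : ∀ g : α → ℝ≥0∞, Measurable g → (∀ x, g x ≤ S x) → ∫⁻ x, g x ^ t ∂μ ≠ ∞ →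
      (∫⁻ x, g x ^ t ∂μ) ^ (1 / t) ≤ ∫⁻ y, B y ∂ν := by
    intro g hg hgS hfin
    set I := ∫⁻ x, g x ^ t ∂μ with hI
    rcases eq_or_ne I 0 with h0 | h0
    · rw [h0, ENNReal.zero_rpow_of_pos (by positivity)]
      exact zero_le
    have step : I ≤ I ^ (1 / Real.conjExponent t) * ∫⁻ y, B y ∂ν := by
      calc I ≤ ∫⁻ x, ∫⁻ y, g x ^ (t - 1) * f x y ∂ν ∂μ := by
            refine lintegral_mono fun x => ?_
            rw [lintegral_const_mul _ (hf.of_uncurry_left : Measurable (f x))]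
            calc g x ^ t = g x ^ (t - 1) * g x := by
                  conv_rhs => rw [← ENNReal.rpow_one (g x), ← ENNReal.rpow_mul, one_mul,
                    ← ENNReal.rpow_add_of_nonneg _ _ (by linarith) zero_le_one]
                  congr 1
                  ring
              _ ≤ g x ^ (t - 1) * S x := by gcongr; exact hgS x
        _ = ∫⁻ y, ∫⁻ x, g x ^ (t - 1) * f x y ∂μ ∂ν := by
            refine lintegral_lintegral_swap (Measurable.aemeasurable ?_)
            exact ((hg.pow_const _).comp measurable_fst).mul hf
        _ ≤ ∫⁻ y, I ^ (1 / Real.conjExponent t) * B y ∂ν := by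
            refine lintegral_mono fun y => ?_
            have := ENNReal.lintegral_mul_le_Lp_mul_Lq μ hconj (hg.pow_const (t - 1)).aemeasurable
              (hf.of_uncurry_right : Measurable fun x => f x y).aemeasurable
            refine this.trans (mul_le_mul' (le_of_eq ?_) ?_)
            · rw [hI]
              congr 1
              refine lintegral_congr fun x => ?_
              rw [← ENNReal.rpow_mul]
              congr 1
              have : t - 1 ≠ 0 := by linarith
              rw [Real.conjExponent]
              field_simp
            · have := h y
              rwa [eNorm_of_ne_top hpt] at this
        _ = _ := lintegral_const_mul _ hB
    have hc0 : 0 < 1 / Real.conjExponent t := one_div_pos.2 hconj.pos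
    have hsum : 1 / Real.conjExponent t + 1 / t = 1 := by
      simpa using hconj.inv_add_inv_eq_one
    have hI0 : I ^ (1 / Real.conjExponent t) ≠ 0 := by simp [h0, hfin]
    have hIt : I ^ (1 / Real.conjExponent t) ≠ ∞ := ENNReal.rpow_ne_top_of_nonneg hc0.le hfin
    rw [← ENNReal.mul_le_mul_iff_right hI0 hIt]
    refine le_trans (le_of_eq ?_) step
    rw [← ENNReal.rpow_add _ _ h0 hfin, hsum, ENNReal.rpow_one]
  set g : ℕ → α → ℝ≥0∞ := fun n => (spanningSets μ n).indicator fun x => min (S x) n with hgdef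
  have hgm : ∀ n, Measurable (g n) := fun n =>
    (hSm.min measurable_const).indicator (measurableSet_spanningSets μ n)
  have hgmono : Monotone g := by
    intro m n hmn x
    simp only [hgdef, Set.indicator]
    split_ifs with h1 h2
    · gcongr
    · exact absurd (monotone_spanningSets μ hmn h1) h2
    · exact zero_le
    · exact le_rfl
  have hsup : ∀ x, ⨆ n, g n x = S x := by
    intro x
    apply le_antisymm
    · refine iSup_le fun n => ?_
      simp only [hgdef, Set.indicator]
      split_ifs
      · exact min_le_left _ _
      · exact zero_le
    · refine le_of_forall_lt fun c hc => ?_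
      obtain ⟨n, hn⟩ := ENNReal.exists_nat_gt hc.ne_top
      have hmem : x ∈ spanningSets μ (max n (spanningSetsIndex μ x)) :=
        monotone_spanningSets μ (le_max_right _ _) (mem_spanningSetsIndex μ x)
      refine lt_of_lt_of_le ?_ (le_iSup _ (max n (spanningSetsIndex μ x)))
      simp only [hgdef, Set.indicator_of_mem hmem]
      refine lt_min hc (hn.trans_le ?_)
      exact_mod_cast le_max_left _ _
  rw [eNorm_of_ne_top hpt, ← ENNReal.le_rpow_inv_iff (by positivity)]
  have : ∫⁻ x, S x ^ t ∂μ = ⨆ n, ∫⁻ x, g n x ^ t ∂μ := by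
    rw [← lintegral_iSup (fun n => (hgm n).pow_const _)
      (fun m n hmn x => ENNReal.rpow_le_rpow (hgmono hmn x) hp0.le)]
    refine lintegral_congr fun x => ?_
    rw [← hsup x]
    exact (ENNReal.orderIsoRpow t hp0).map_iSup _
  rw [this]
  refine iSup_le fun n => ?_
  rw [ENNReal.le_rpow_inv_iff (by positivity)]
  refine bound _ (hgm n) (fun x => (le_iSup (fun n => g n x) n).trans_eq (hsup x)) ?_
  have : ∫⁻ x, g n x ^ t ∂μ ≤
      ∫⁻ x, (spanningSets μ n).indicator (fun _ => (n : ℝ≥0∞) ^ t) x ∂μ := by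
    refine lintegral_mono fun x => ?_
    simp only [hgdef, Set.indicator]
    split_ifs
    · exact ENNReal.rpow_le_rpow (min_le_right _ _) hp0.le
    · simp [hp0]
  refine (this.trans_lt ?_).ne
  rw [lintegral_indicator (measurableSet_spanningSets μ n), setLIntegral_const]
  exact ENNReal.mul_lt_top (ENNReal.rpow_lt_top_of_nonneg hp0.le (by simp))
    (measure_spanningSets_lt_top μ n)

/-- **Young's inequality** for a bilinear pairing along maps that preserve the measure in each
variable. The bound is given by a measurable majorant of the slice norms. -/
lemma eNorm_young [SFinite μ] {s r : ℝ≥0∞} (hs : 1 ≤ s) (hp : 1 ≤ p) (hq : 1 ≤ q) (hr : 1 ≤ r)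
    (hsp : s ≤ p) (hsq : s ≤ q) (h : iv s + iv r = iv p + iv q) {T : α → α → α}
    (hT : Measurable (Function.uncurry T)) (hT₁ : ∀ y, MeasurePreserving (fun x => T x y) μ μ)
    (hT₂ : ∀ x, MeasurePreserving (T x) μ μ) (hF : Measurable F) (hG : Measurable G) :
    ∃ D : α → ℝ≥0∞, Measurable D ∧ (∀ y, eNorm μ s (fun x => F x * G (T x y)) ≤ D y) ∧
      eNorm μ r D ≤ eNorm μ p F * eNorm μ q G := by
  by_cases hrt : r = ∞
  · subst hrt
    refine ⟨fun _ => eNorm μ p F * eNorm μ q G, measurable_const, fun y => ?_, ?_⟩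
    · refine (eNorm_mul_le hs hp hq (by simpa [iv_top] using h) hF
        (hG.comp (hT₁ y).measurable)).trans_eq ?_
      exact congrArg _ (eNorm_comp (hT₁ y) hG)
    · rw [eNorm_top]
      exact essSup_le_of_ae_le _ (ae_of_all _ fun _ => le_rfl)
  have hrp := iv_pos hr hrt
  have hpt : p ≠ ∞ := ne_top_of_iv_pos (by linarith [(iv_le_iv_iff hq hs).2 hsq])
  have hqt : q ≠ ∞ := ne_top_of_iv_pos (by linarith [(iv_le_iv_iff hp hs).2 hsp])
  have hst : s ≠ ∞ := ne_top_of_le_ne_top hpt hsp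
  have hspr : s.toReal ≤ p.toReal := ENNReal.toReal_mono hpt hsp
  have hsqr : s.toReal ≤ q.toReal := ENNReal.toReal_mono hqt hsq
  have hP := eNorm_rpow_toReal (μ := μ) (F := F) hp hpt
  have hQ := eNorm_rpow_toReal (μ := μ) (F := G) hq hqt
  have hs0 := toReal_exponent_pos hs hst
  have hp0 := toReal_exponent_pos hp hpt
  have hq0 := toReal_exponent_pos hq hqt
  have hr0 := toReal_exponent_pos hr hrt
  rw [iv_eq, iv_eq, iv_eq, iv_eq] at h
  simp only [eNorm_of_ne_top hst, eNorm_of_ne_top hrt]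
  set s' := s.toReal
  set p' := p.toReal
  set q' := q.toReal
  set r' := r.toReal
  set P := eNorm μ p F
  set Q := eNorm μ q G
  have hjoint : Measurable (fun z : α × α => F z.1 * G (T z.1 z.2)) :=
    (hF.comp measurable_fst).mul (hG.comp hT)
  refine ⟨fun y => (∫⁻ x, (F x * G (T x y)) ^ s' ∂μ) ^ (1 / s'),
    ((hjoint.pow_const s').lintegral_prod_left').pow_const _, fun y => le_rfl, ?_⟩
  have hw₂ : 0 ≤ 1 - s' / q' := by rw [sub_nonneg, div_le_one hq0]; exact hsqr
  have hw₃ : 0 ≤ 1 - s' / p' := by rw [sub_nonneg, div_le_one hp0]; exact hspr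
  have hrel : s' / p' + s' / q' = 1 + s' / r' := by field_simp at h ⊢; linarith
  have hpoint : ∀ a b : ℝ≥0∞, (a * b) ^ s' =
      (a ^ p' * b ^ q') ^ (s' / r') * ((a ^ p') ^ (1 - s' / q') * (b ^ q') ^ (1 - s' / p')) := by
    intro a b
    rw [ENNReal.mul_rpow_of_nonneg _ _ hs0.le, ENNReal.mul_rpow_of_nonneg _ _ (by positivity),
      mul_mul_mul_comm]
    simp only [← ENNReal.rpow_mul]
    rw [← ENNReal.rpow_add_of_nonneg _ _ (by positivity) (by positivity),
      ← ENNReal.rpow_add_of_nonneg _ _ (by positivity) (by positivity)]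
    congr 2
    · have : s' / r' + (1 - s' / q') = s' / p' := by linarith
      rw [← mul_add, this]; field_simp
    · have : s' / r' + (1 - s' / p') = s' / q' := by linarith
      rw [← mul_add, this]; field_simp
  have hslice : ∀ y, ∫⁻ x, (F x * G (T x y)) ^ s' ∂μ ≤
      (∫⁻ x, F x ^ p' * G (T x y) ^ q' ∂μ) ^ (s' / r') *
        ((P ^ p') ^ (1 - s' / q') * (Q ^ q') ^ (1 - s' / p')) := by
    intro y
    have hGy : Measurable fun x => G (T x y) := hG.comp (hT₁ y).measurable
    have := ENNReal.lintegral_prod_norm_pow_le (μ := μ) (Finset.univ : Finset (Fin 3))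
      (f := ![fun x => F x ^ p' * G (T x y) ^ q', fun x => F x ^ p', fun x => G (T x y) ^ q'])
      (p := ![s' / r', 1 - s' / q', 1 - s' / p'])
      (by
        intro i _
        fin_cases i
        · exact ((hF.pow_const _).mul (hGy.pow_const _)).aemeasurable
        · exact (hF.pow_const _).aemeasurable
        · exact (hGy.pow_const _).aemeasurable)
      (by simp [Fin.sum_univ_three]; linarith)
      (by
        intro i _
        fin_cases i
        · exact (by positivity : (0 : ℝ) ≤ s' / r')
        · exact hw₂
        · exact hw₃)
    simp only [Fin.prod_univ_three, Matrix.cons_val_zero, Matrix.cons_val_one,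
      Matrix.cons_val_two, Matrix.tail_cons, Matrix.head_cons] at this
    simp only [hpoint, hP, ← mul_assoc] at this ⊢
    refine this.trans_eq ?_
    rw [hQ, (hT₁ y).lintegral_comp (hG.pow_const q')]
  have hK : ∫⁻ y, ∫⁻ x, F x ^ p' * G (T x y) ^ q' ∂μ ∂μ = P ^ p' * Q ^ q' := by
    rw [lintegral_lintegral_swap]
    · rw [hP, hQ, ← lintegral_mul_const _ (hF.pow_const _)]
      refine lintegral_congr fun x => ?_
      have hGx : Measurable fun y => G (T x y) := hG.comp (hT₂ x).measurable
      rw [lintegral_const_mul _ (hGx.pow_const _), (hT₂ x).lintegral_comp (hG.pow_const q')]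
    · refine Measurable.aemeasurable ?_
      exact ((hF.comp measurable_snd).pow_const _).mul
        ((hG.comp (hT.comp measurable_swap)).pow_const _)
  have hKm : Measurable fun y => ∫⁻ x, F x ^ p' * G (T x y) ^ q' ∂μ := by
    refine Measurable.lintegral_prod_left' (f := fun z : α × α => F z.1 ^ p' * G (T z.1 z.2) ^ q') ?_
    exact ((hF.comp measurable_fst).pow_const _).mul ((hG.comp hT).pow_const _)
  calc (∫⁻ y, ((∫⁻ x, (F x * G (T x y)) ^ s' ∂μ) ^ (1 / s')) ^ r' ∂μ) ^ (1 / r')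
      ≤ (∫⁻ y, (∫⁻ x, F x ^ p' * G (T x y) ^ q' ∂μ) *
        ((P ^ p') ^ (1 - s' / q') * (Q ^ q') ^ (1 - s' / p')) ^ (r' / s') ∂μ) ^ (1 / r') := by
        gcongr with y
        rw [← ENNReal.rpow_mul]
        have e1 : 1 / s' * r' = r' / s' := by ring
        have e2 : s' / r' * (r' / s') = 1 := by field_simp
        rw [e1]
        refine (ENNReal.rpow_le_rpow (hslice y) (by positivity)).trans_eq ?_
        rw [ENNReal.mul_rpow_of_nonneg _ _ (by positivity), ← ENNReal.rpow_mul, e2,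
          ENNReal.rpow_one]
    _ = P * Q := by
        rw [lintegral_mul_const _ hKm, hK,
          ENNReal.mul_rpow_of_nonneg _ _ (by positivity : 0 ≤ r' / s'), mul_mul_mul_comm,
          ENNReal.mul_rpow_of_nonneg _ _ (by positivity)]
        simp only [← ENNReal.rpow_mul]
        rw [← ENNReal.rpow_add_of_nonneg _ _ (by positivity) (by positivity),
          ← ENNReal.rpow_add_of_nonneg _ _ (by positivity) (by positivity),
          ← ENNReal.rpow_mul, ← ENNReal.rpow_mul]
        have e1 : (p' + p' * (1 - s' / q') * (r' / s')) * (1 / r') = 1 := by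
          have : 1 - s' / q' = s' / p' - s' / r' := by linarith
          rw [this]; field_simp; ring
        have e2 : (q' + q' * (1 - s' / p') * (r' / s')) * (1 / r') = 1 := by
          have : 1 - s' / p' = s' / q' - s' / r' := by linarith
          rw [this]; field_simp; ring
        rw [e1, e2, ENNReal.rpow_one, ENNReal.rpow_one]

end MixedNorms

section ShortTimeFourier

lemma lintegral_mul_const_mul_lintegral_swap {α β : Type*} [MeasurableSpace α]
    [MeasurableSpace β] {μ : Measure α} {ν : Measure β} [SFinite μ] [SFinite ν] (K : ℝ≥0∞)
    {F : α → β → ℝ≥0∞} {G : α → ℝ≥0∞} {H : β → ℝ≥0∞} (hF : Measurable (Function.uncurry F))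
    (hG : Measurable G) (hH : Measurable H) :
    ∫⁻ x, G x * (K * ∫⁻ y, H y * F x y ∂ν) ∂μ = K * ∫⁻ y, H y * ∫⁻ x, F x y * G x ∂μ ∂ν := by
  have hx : ∀ x, Measurable (F x) := fun x => hF.of_uncurry_left
  have hy : ∀ y, Measurable fun x => F x y := fun y => hF.of_uncurry_right
  have hHF : ∀ x, Measurable fun y => H y * F x y := fun x => hH.mul (hx x)
  have hFG : ∀ y, Measurable fun x => F x y * G x := fun y => (hy y).mul hG
  calc ∫⁻ x, G x * (K * ∫⁻ y, H y * F x y ∂ν) ∂μ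
      = K * ∫⁻ x, ∫⁻ y, H y * (F x y * G x) ∂ν ∂μ := by
        rw [← lintegral_const_mul]
        · refine lintegral_congr fun x => ?_
          rw [mul_left_comm, ← lintegral_const_mul _ (hHF x)]
          simp only [mul_comm, mul_left_comm]
        · exact Measurable.lintegral_prod_right' (f := fun z : α × β => H z.2 * (F z.1 z.2 * G z.1))
            ((hH.comp measurable_snd).mul (hF.mul (hG.comp measurable_fst)))
    _ = K * ∫⁻ y, ∫⁻ x, H y * (F x y * G x) ∂μ ∂ν := by
        rw [lintegral_lintegral_swap]
        exact ((hH.comp measurable_snd).mul (hF.mul (hG.comp measurable_fst))).aemeasurable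
    _ = _ := by
        congr 1
        refine lintegral_congr fun y => ?_
        rw [lintegral_const_mul _ (hFG y)]

variable {d : ℕ}

lemma norm_e2pi (a : ℝ) : ‖e2pi a‖ = 1 := by
  rw [e2pi, show 2 * (Real.pi : ℂ) * I * a = ((2 * Real.pi * a : ℝ) : ℂ) * I by push_cast; ring]
  exact Complex.norm_exp_ofReal_mul_I _

lemma e2pi_add (a b : ℝ) : e2pi (a + b) = e2pi a * e2pi b := by
  rw [e2pi, e2pi, e2pi, ← Complex.exp_add]
  push_cast
  ring_nf

@[fun_prop]
lemma continuous_e2pi : Continuous e2pi := by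
  unfold e2pi
  fun_prop

@[fun_prop]
lemma continuous_gauss : Continuous (gauss d) := by
  unfold gauss
  fun_prop

lemma norm_gauss (x : Ed d) : ‖gauss d x‖ = Real.exp (-‖x‖ ^ 2) := by
  simp [gauss, -Complex.ofReal_exp, abs_of_pos (Real.exp_pos _)]

lemma norm_gauss_le_one (x : Ed d) : ‖gauss d x‖ ≤ 1 := by
  rw [norm_gauss]
  exact Real.exp_le_one_iff.2 (by simp)

lemma integrable_exp_neg_mul_sq_norm {b : ℝ} (hb : 0 < b) :
    Integrable (fun x : Ed d => Real.exp (-b * ‖x‖ ^ 2)) := by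
  have := (GaussianFourier.integrable_cexp_neg_mul_sq_norm_add (V := Ed d) (b := b)
    (by simpa using hb) 0 0).re
  refine this.congr (ae_of_all _ fun x => ?_)
  simp only [zero_mul, add_zero]
  rw [show -(b : ℂ) * (‖x‖ : ℂ) ^ 2 = ((-b * ‖x‖ ^ 2 : ℝ) : ℂ) by push_cast; ring]
  exact Complex.exp_ofReal_re _

lemma continuous_STFT (f : SchwartzMap (Ed d) ℂ) :
    Continuous fun z : Ed d × Ed d => STFT d (gauss d) f z.1 z.2 := by
  unfold STFT
  refine continuous_of_dominated (bound := fun y => ‖f y‖) ?_ ?_ f.integrable.norm ?_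
  · intro z
    have := f.continuous
    exact (by fun_prop : Continuous fun y => f y * e2pi (-⟪y, z.2⟫) *
      gauss d (y - z.1)).aestronglyMeasurable
  · refine fun z => ae_of_all _ fun y => ?_
    rw [norm_mul, norm_mul, norm_e2pi, mul_one]
    exact mul_le_of_le_one_right (norm_nonneg _) (norm_gauss_le_one _)
  · exact ae_of_all _ fun y => by fun_prop

/-- A Gaussian is a superposition of characters with Gaussian weight. -/
lemma exists_exp_neg_two_eq_integral (d : ℕ) : ∃ c : ℂ, ∀ z : Ed d,
    ((Real.exp (-2 * ‖z‖ ^ 2) : ℝ) : ℂ) =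
      c * ∫ η : Ed d, ((Real.exp (-(Real.pi ^ 2 / 2) * ‖η‖ ^ 2) : ℝ) : ℂ) * e2pi ⟪η, z⟫ := by
  have hb : 0 < (((Real.pi ^ 2 / 2 : ℝ) : ℂ)).re := by
    rw [Complex.ofReal_re]
    positivity
  have hpi : (Real.pi : ℂ) ≠ 0 := by exact_mod_cast Real.pi_ne_zero
  set a : ℂ := (Real.pi / ((Real.pi ^ 2 / 2 : ℝ) : ℂ)) ^ (Module.finrank ℝ (Ed d) / 2 : ℂ)
  have ha : a ≠ 0 := by
    refine Complex.cpow_ne_zero_iff.2 (Or.inl (div_ne_zero hpi ?_))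
    exact_mod_cast (by positivity : Real.pi ^ 2 / 2 ≠ 0)
  refine ⟨a⁻¹, fun z => ?_⟩
  have := GaussianFourier.integral_cexp_neg_mul_sq_norm_add (V := Ed d) hb (2 * Real.pi * I) z
  rw [eq_inv_mul_iff_mul_eq₀ ha]
  have e : (2 * Real.pi * I) ^ 2 * (‖z‖ : ℂ) ^ 2 / (4 * ((Real.pi ^ 2 / 2 : ℝ) : ℂ)) =
      ((-2 * ‖z‖ ^ 2 : ℝ) : ℂ) := by
    push_cast
    rw [mul_pow, I_sq]
    field_simp
    ring
  rw [e] at this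
  rw [Complex.ofReal_exp, ← this]
  refine integral_congr_ae (ae_of_all _ fun η => ?_)
  simp only [e2pi]
  rw [Complex.ofReal_exp, ← Complex.exp_add, real_inner_comm]
  push_cast
  ring_nf

/-- Multiplying by a Gaussian bump centered at `m` averages the short-time Fourier transform over
frequencies. -/
lemma exists_enorm_integral_gauss_mul_le (d : ℕ) : ∃ K : ℝ≥0, ∀ (f : SchwartzMap (Ed d) ℂ)
    (t ν m : Ed d),
    ‖∫ y, f y * e2pi (-⟪y, ν⟫) * gauss d (y - t) * (Real.exp (-2 * ‖y - m‖ ^ 2) : ℝ)‖ₑ ≤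
      K * ∫⁻ η : Ed d, ENNReal.ofReal (Real.exp (-(Real.pi ^ 2 / 2) * ‖η‖ ^ 2)) *
        ‖STFT d (gauss d) f t (ν - η)‖ₑ := by
  obtain ⟨c, hc⟩ := exists_exp_neg_two_eq_integral d
  refine ⟨‖c‖₊, fun f t ν m => ?_⟩
  set g : Ed d → ℝ := fun η => Real.exp (-(Real.pi ^ 2 / 2) * ‖η‖ ^ 2)
  have hgc : Continuous g := by fun_prop
  have hgi : Integrable g := integrable_exp_neg_mul_sq_norm (by positivity)
  have hfc := f.continuous
  set u : Ed d → ℂ := fun y => f y * e2pi (-⟪y, ν⟫) * gauss d (y - t) with hu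
  have huc : Continuous u := by fun_prop
  have hui : Integrable u := by
    refine f.integrable.mono huc.aestronglyMeasurable (ae_of_all _ fun y => ?_)
    rw [hu, norm_mul, norm_mul, norm_e2pi, mul_one]
    exact mul_le_of_le_one_right (norm_nonneg _) (norm_gauss_le_one _)
  have hprod : Integrable (Function.uncurry fun y η : Ed d => u y * (g η * e2pi ⟪η, y - m⟫)) := by
    refine (hui.mul_prod hgi.ofReal).mono (Continuous.aestronglyMeasurable (by fun_prop))
      (ae_of_all _ fun z => ?_)
    simp [Function.uncurry, norm_e2pi]
  have key : ∫ y, u y * (Real.exp (-2 * ‖y - m‖ ^ 2) : ℝ) =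
      c * ∫ η, (g η : ℂ) * e2pi (-⟪η, m⟫) * STFT d (gauss d) f t (ν - η) := by
    calc ∫ y, u y * (Real.exp (-2 * ‖y - m‖ ^ 2) : ℝ)
        = ∫ y, c * ∫ η, u y * (g η * e2pi ⟪η, y - m⟫) := by
          refine integral_congr_ae (ae_of_all _ fun y => ?_)
          simp only [hc, integral_const_mul]
          ring
      _ = c * ∫ η, ∫ y, u y * (g η * e2pi ⟪η, y - m⟫) := by
          rw [integral_const_mul, integral_integral_swap hprod]
      _ = _ := by
          congr 1
          refine integral_congr_ae (ae_of_all _ fun η => ?_)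
          simp only [STFT, ← integral_const_mul]
          refine integral_congr_ae (ae_of_all _ fun y => ?_)
          have : e2pi (-⟪y, ν - η⟫) = e2pi (-⟪y, ν⟫) * e2pi ⟪η, y⟫ := by
            rw [← e2pi_add, inner_sub_right, real_inner_comm η y]
            ring_nf
          have h' : e2pi ⟪η, y - m⟫ = e2pi ⟪η, y⟫ * e2pi (-⟪η, m⟫) := by
            rw [← e2pi_add, inner_sub_right, sub_eq_add_neg]
          simp only [hu, this, h']
          ring
  rw [key, enorm_mul]
  gcongr
  · rfl
  refine (enorm_integral_le_lintegral_enorm _).trans (lintegral_mono fun η => ?_)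
  rw [enorm_mul, enorm_mul]
  have h1 : ‖e2pi (-⟪η, m⟫)‖ₑ = 1 := by rw [← ofReal_norm, norm_e2pi, ENNReal.ofReal_one]
  have h2 : ‖(g η : ℂ)‖ₑ = ENNReal.ofReal (g η) := by
    rw [← ofReal_norm, Complex.norm_real, Real.norm_of_nonneg (Real.exp_pos _).le]
  rw [h1, h2, mul_one]

/-- The modulus of the short-time Fourier transform is dominated by its convolution with a
Gaussian in time and frequency. -/
lemma exists_enorm_STFT_le_convolution (d : ℕ) : ∃ K : ℝ≥0, ∀ (f : SchwartzMap (Ed d) ℂ)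
    (t ν : Ed d),
    ‖STFT d (gauss d) f t ν‖ₑ ≤
      K * ∫⁻ ν' : Ed d, ENNReal.ofReal (Real.exp (-(Real.pi ^ 2 / 2) * ‖ν - ν'‖ ^ 2)) *
        ∫⁻ t' : Ed d, ‖STFT d (gauss d) f t' ν'‖ₑ *
          ENNReal.ofReal (Real.exp (-(1 / 2) * ‖t - t'‖ ^ 2)) := by
  obtain ⟨K, hK⟩ := exists_enorm_integral_gauss_mul_le d
  set k : Ed d → ℂ := fun x => gauss d x ^ 2 with hk
  set M : ℝ := ∫ x : Ed d, Real.exp (-2 * ‖x‖ ^ 2) with hM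
  have hk_eq : ∀ x, k x = ((Real.exp (-2 * ‖x‖ ^ 2) : ℝ) : ℂ) := by
    intro x
    simp only [hk, gauss]
    rw [← Complex.ofReal_pow, ← Real.exp_nat_mul]
    congr 2
    push_cast
    ring
  have hki : Integrable k := by
    simp only [funext hk_eq]
    exact (integrable_exp_neg_mul_sq_norm two_pos).ofReal
  have hkM : ∫ x, k x = (M : ℂ) := by
    simp only [hk_eq, hM]
    exact integral_ofReal
  have hM0 : 0 < M := by
    rw [hM, GaussianFourier.integral_rexp_neg_mul_sq_norm two_pos]
    positivity
  refine ⟨(‖M‖₊)⁻¹ * K, fun f t ν => ?_⟩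
  have hfc := f.continuous
  set u : Ed d → ℂ := fun y => f y * e2pi (-⟪y, ν⟫) * gauss d (y - t) with hu
  have huc : Continuous u := by fun_prop
  have hui : Integrable u := by
    refine f.integrable.mono huc.aestronglyMeasurable (ae_of_all _ fun y => ?_)
    rw [hu, norm_mul, norm_mul, norm_e2pi, mul_one]
    exact mul_le_of_le_one_right (norm_nonneg _) (norm_gauss_le_one _)
  have hconv : ∫ t', ∫ y, u y * k (t' - y) = STFT d (gauss d) f t ν * M := by
    have h := integral_integral_swap
      (f := fun t' y => ContinuousLinearMap.mul ℝ ℂ (u y) (k (t' - y)))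
      (hui.convolution_integrand (ContinuousLinearMap.mul ℝ ℂ) hki)
    simp only [ContinuousLinearMap.mul_apply'] at h
    rw [h]
    simp only [integral_const_mul, integral_sub_right_eq_self k, integral_mul_const, hkM]
    rfl
  have hinner : ∀ t', ‖∫ y, u y * k (t' - y)‖ₑ ≤
      ENNReal.ofReal (Real.exp (-(1 / 2) * ‖t - t'‖ ^ 2)) * (K *
        ∫⁻ η : Ed d, ENNReal.ofReal (Real.exp (-(Real.pi ^ 2 / 2) * ‖η‖ ^ 2)) *
          ‖STFT d (gauss d) f t' (ν - η)‖ₑ) := by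
    intro t'
    set m : Ed d := (2⁻¹ : ℝ) • (t + t') with hm
    have hgg : ∀ y, gauss d (y - t) * k (t' - y) = gauss d (y - t') *
        ((Real.exp (-(1 / 2) * ‖t - t'‖ ^ 2) : ℝ) * (Real.exp (-2 * ‖y - m‖ ^ 2) : ℝ)) := by
      intro y
      rw [hk_eq]
      simp only [gauss]
      rw [← Complex.ofReal_mul, ← Complex.ofReal_mul, ← Complex.ofReal_mul, ← Real.exp_add,
        ← Real.exp_add, ← Real.exp_add]
      congr 2
      have hym : y - m = (2⁻¹ : ℝ) • ((y - t) + (y - t')) := by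
        rw [hm]
        module
      have htt : t - t' = (y - t') - (y - t) := by abel
      rw [hym, htt, norm_sub_rev t' y]
      generalize y - t = a
      generalize y - t' = b
      rw [norm_smul, mul_pow, norm_sub_sq_real, norm_add_sq_real, real_inner_comm]
      norm_num
      ring
    have heq : ∫ y, u y * k (t' - y) = ((Real.exp (-(1 / 2) * ‖t - t'‖ ^ 2) : ℝ) : ℂ) *
        ∫ y, f y * e2pi (-⟪y, ν⟫) * gauss d (y - t') * (Real.exp (-2 * ‖y - m‖ ^ 2) : ℝ) := by
      rw [← integral_const_mul]
      refine integral_congr_ae (ae_of_all _ fun y => ?_)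
      simp only [hu]
      rw [mul_assoc, hgg]
      ring
    rw [heq, enorm_mul]
    refine mul_le_mul' (le_of_eq ?_) (hK f t' ν m)
    rw [← ofReal_norm, Complex.norm_real, Real.norm_of_nonneg (Real.exp_pos _).le]
  have hcont := continuous_STFT f
  have hmeas : Measurable fun z : Ed d × Ed d => ‖STFT d (gauss d) f z.1 z.2‖ₑ :=
    hcont.measurable.enorm
  have hbound : ‖STFT d (gauss d) f t ν‖ₑ * ‖M‖₊ ≤
      K * ∫⁻ ν' : Ed d, ENNReal.ofReal (Real.exp (-(Real.pi ^ 2 / 2) * ‖ν - ν'‖ ^ 2)) *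
        ∫⁻ t' : Ed d, ‖STFT d (gauss d) f t' ν'‖ₑ *
          ENNReal.ofReal (Real.exp (-(1 / 2) * ‖t - t'‖ ^ 2)) := by
    calc ‖STFT d (gauss d) f t ν‖ₑ * ‖M‖₊
        = ‖∫ t', ∫ y, u y * k (t' - y)‖ₑ := by
          rw [hconv, enorm_mul]
          congr 1
          rw [← ofReal_norm, Complex.norm_real, ofReal_norm]
          rfl
      _ ≤ ∫⁻ t', ‖∫ y, u y * k (t' - y)‖ₑ := enorm_integral_le_lintegral_enorm _
      _ ≤ ∫⁻ t' : Ed d, ENNReal.ofReal (Real.exp (-(1 / 2) * ‖t - t'‖ ^ 2)) * (K *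
            ∫⁻ ν' : Ed d, ENNReal.ofReal (Real.exp (-(Real.pi ^ 2 / 2) * ‖ν - ν'‖ ^ 2)) *
              ‖STFT d (gauss d) f t' ν'‖ₑ) := by
          refine lintegral_mono fun t' => (hinner t').trans_eq ?_
          congr 2
          have := lintegral_sub_left_eq_self (μ := (volume : Measure (Ed d))) (fun η =>
            ENNReal.ofReal (Real.exp (-(Real.pi ^ 2 / 2) * ‖η‖ ^ 2)) *
              ‖STFT d (gauss d) f t' (ν - η)‖ₑ) ν
          rw [← this]
          simp only [sub_sub_cancel]
      _ = _ := lintegral_mul_const_mul_lintegral_swap K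
          (F := fun t' ν' => ‖STFT d (gauss d) f t' ν'‖ₑ) hmeas (by fun_prop) (by fun_prop)
  have hne : (‖M‖₊ : ℝ≥0∞) ≠ 0 := by simpa using hM0.ne'
  rw [ENNReal.coe_mul, ENNReal.coe_inv (by simpa using hM0.ne'), mul_assoc,
    ← ENNReal.div_eq_inv_mul, ENNReal.le_div_iff_mul_le (Or.inl hne) (Or.inl ENNReal.coe_ne_top)]
  exact hbound

end ShortTimeFourier

section Convolution

variable {E : Type*} [AddCommGroup E] [MeasurableSpace E] [MeasurableAdd₂ E]
  {μ : Measure E} [SFinite μ] [μ.IsAddLeftInvariant]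

/-- Iterated mixed-norm bound for a product of two functions and a function of the sum. -/
lemma eNorm_mul_sum_le {s₁ s₂ s₃ z w q₁ q₂ : ℝ≥0∞} (hs₁ : 1 ≤ s₁) (hs₂ : 1 ≤ s₂)
    (hs₃ : 1 ≤ s₃) (hz : 1 ≤ z) (hw : 1 ≤ w) (hq₁ : 1 ≤ q₁) (hq₂ : 1 ≤ q₂) (hs₁q₁ : s₁ ≤ q₁)
    (hs₁w : s₁ ≤ w) (hs₂q₂ : s₂ ≤ q₂) (hs₂z : s₂ ≤ z) (h₁ : iv s₁ + iv z = iv q₁ + iv w)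
    (h₂ : iv s₂ + iv s₃ = iv q₂ + iv z) {a b c : E → ℝ≥0∞} (ha : Measurable a)
    (hb : Measurable b) (hc : Measurable c) :
    eNorm μ s₃ (fun ν => eNorm μ s₂ fun ξ₂ =>
      eNorm μ s₁ fun ξ₁ => a ξ₁ * b ξ₂ * c (ν + ξ₁ + ξ₂)) ≤
      eNorm μ q₁ a * eNorm μ q₂ b * eNorm μ w c := by
  have hT : Measurable (Function.uncurry fun x y : E => y + x) :=
    measurable_snd.add measurable_fst
  have hT₁ : ∀ y, MeasurePreserving (fun x : E => y + x) μ μ :=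
    fun y => measurePreserving_add_left μ y
  have hT₂ : ∀ x, MeasurePreserving (fun y : E => y + x) μ μ :=
    fun x => measurePreserving_add_right μ x
  obtain ⟨D, hDm, hD, hDr⟩ := eNorm_young hs₁ hq₁ hw hz hs₁q₁ hs₁w h₁ hT hT₁ hT₂ ha hc
  obtain ⟨D', -, hD', hDr'⟩ := eNorm_young hs₂ hq₂ hz hs₃ hs₂q₂ hs₂z h₂ hT hT₁ hT₂ hb hDm
  have inner : ∀ ν ξ₂, eNorm μ s₁ (fun ξ₁ => a ξ₁ * b ξ₂ * c (ν + ξ₁ + ξ₂)) ≤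
      b ξ₂ * D (ν + ξ₂) := by
    intro ν ξ₂
    have hm : Measurable fun ξ₁ => a ξ₁ * c (ν + ξ₂ + ξ₁) :=
      ha.mul (hc.comp (hT₁ _).measurable)
    calc _ = eNorm μ s₁ fun ξ₁ => b ξ₂ * (a ξ₁ * c (ν + ξ₂ + ξ₁)) := by
            congr 1
            funext ξ₁
            rw [add_right_comm ν ξ₁ ξ₂]
            ring
      _ = _ := eNorm_const_mul hs₁ _ hm
      _ ≤ _ := by
            gcongr
            exact hD _
  calc _ ≤ eNorm μ s₃ D' := eNorm_mono fun ν => (eNorm_mono (inner ν)).trans (hD' ν)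
    _ ≤ eNorm μ q₂ b * eNorm μ z D := hDr'
    _ ≤ eNorm μ q₂ b * (eNorm μ q₁ a * eNorm μ w c) := by gcongr
    _ = _ := by ring

variable [MeasurableNeg E] [μ.IsNegInvariant]

/-- Iterated mixed-norm bound for a product of two translates and a fixed function. -/
lemma eNorm_mul_translates_le {r₀ r₁ r₂ u w p₁ p₂ : ℝ≥0∞} (hr₀ : 1 ≤ r₀) (hr₁ : 1 ≤ r₁)
    (hr₂ : 1 ≤ r₂) (hu : 1 ≤ u) (hw : 1 ≤ w) (hp₁ : 1 ≤ p₁) (hp₂ : 1 ≤ p₂) (hr₀u : r₀ ≤ u)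
    (hr₀p₁ : r₀ ≤ p₁) (huw : u ≤ w) (hup₂ : u ≤ p₂) (h₁ : iv r₀ + iv r₁ = iv u + iv p₁)
    (h₂ : iv u + iv r₂ = iv w + iv p₂) {a b c : E → ℝ≥0∞} (ha : Measurable a)
    (hb : Measurable b) (hc : Measurable c) :
    eNorm μ r₂ (fun t₂ => eNorm μ r₁ fun t₁ =>
      eNorm μ r₀ fun x => a (x - t₁) * b (x - t₂) * c x) ≤
      eNorm μ p₁ a * eNorm μ p₂ b * eNorm μ w c := by
  have hT₁ : ∀ y, MeasurePreserving (fun x : E => x - y) μ μ :=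
    fun y => measurePreserving_sub_right μ y
  have hT₂ : ∀ x, MeasurePreserving (fun y : E => x - y) μ μ :=
    fun x => Measure.measurePreserving_sub_left μ x
  obtain ⟨D, hDm, hD, hDr⟩ := eNorm_young hu hw hp₂ hr₂ huw hup₂ h₂
    (T := fun x y => x - y) measurable_sub hT₁ hT₂ hc hb
  have inner : ∀ t₂, eNorm μ r₁ (fun t₁ => eNorm μ r₀ fun x => a (x - t₁) * b (x - t₂) * c x) ≤
      eNorm μ p₁ a * D t₂ := by
    intro t₂
    obtain ⟨D', -, hD', hDr'⟩ := eNorm_young hr₀ hu hp₁ hr₁ hr₀u hr₀p₁ h₁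
      (T := fun x y => x - y) measurable_sub hT₁ hT₂
      (hc.mul (hb.comp (hT₁ t₂).measurable)) ha
    calc _ ≤ eNorm μ r₁ D' := eNorm_mono fun t₁ => by
            refine le_trans (le_of_eq ?_) (hD' t₁)
            congr 1
            funext x
            simp only [Pi.mul_apply, Function.comp_apply]
            ring
      _ ≤ _ := hDr'
      _ ≤ _ := by
            rw [mul_comm]
            gcongr
            exact hD t₂
  calc _ ≤ eNorm μ r₂ fun t₂ => eNorm μ p₁ a * D t₂ := eNorm_mono inner
    _ = eNorm μ p₁ a * eNorm μ r₂ D := eNorm_const_mul hr₂ _ hDm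
    _ ≤ eNorm μ p₁ a * (eNorm μ w c * eNorm μ p₂ b) := by gcongr
    _ = _ := by ring

end Convolution

section ModulationSpaces

lemma measurable_eNorm_of_continuous {α β : Type*} [TopologicalSpace α] [MeasurableSpace α]
    [BorelSpace α] [TopologicalSpace β] [MeasurableSpace β] [BorelSpace β]
    [SecondCountableTopologyEither α β] {μ : Measure α} [SFinite μ] [μ.IsOpenPosMeasure]
    (p : ℝ≥0∞) {F : α → β → ℝ≥0∞} (hF : Continuous (Function.uncurry F)) :
    Measurable fun b => eNorm μ p fun a => F a b := by
  have hslice : ∀ b, Continuous fun a => F a b := fun b =>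
    hF.comp (by fun_prop : Continuous fun a => (a, b))
  by_cases hp : p = ∞
  · subst hp
    simp only [eNorm_top]
    have : (fun b => essSup (fun a => F a b) μ) = fun b => ⨆ a, F a b := by
      funext b
      refine le_antisymm (essSup_le_of_ae_le _ (ae_of_all _ fun a => le_iSup (fun a => F a b) a))
        (iSup_le fun a => ?_)
      by_contra! hlt
      have hopen : IsOpen {x | essSup (fun a => F a b) μ < F x b} :=
        isOpen_lt continuous_const (hslice b)
      refine hopen.measure_ne_zero μ ⟨a, hlt⟩ ?_
      exact meas_essSup_lt
    rw [this]
    exact (lowerSemicontinuous_iSup fun a =>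
      (hF.comp (by fun_prop : Continuous fun b => (a, b))).lowerSemicontinuous).measurable
  · simp only [eNorm_of_ne_top hp]
    exact ((hF.measurable.pow_const p.toReal).lintegral_prod_left').pow_const _

variable {d : ℕ} {p q pt qt : ℝ≥0∞}

lemma eNorm_exp_neg_mul_sq_norm_ne_top (hp : 1 ≤ p) {b : ℝ} (hb : 0 < b) :
    eNorm volume p (fun x : Ed d => ENNReal.ofReal (Real.exp (-b * ‖x‖ ^ 2))) ≠ ∞ := by
  by_cases h : p = ∞
  · subst h
    rw [eNorm_top]
    refine ne_top_of_le_ne_top ENNReal.one_ne_top (essSup_le_of_ae_le _ (ae_of_all _ fun x => ?_))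
    rw [ENNReal.ofReal_le_one, Real.exp_le_one_iff]
    nlinarith [sq_nonneg ‖x‖]
  · have hp0 := toReal_exponent_pos hp h
    rw [eNorm_of_ne_top h]
    refine ENNReal.rpow_ne_top_of_nonneg (by positivity) ?_
    have := (integrable_exp_neg_mul_sq_norm (d := d) (mul_pos hb hp0)).lintegral_lt_top.ne
    convert this using 4 with x
    rw [ENNReal.ofReal_rpow_of_pos (Real.exp_pos _), ← Real.exp_mul]
    ring_nf

/-- Modulation spaces increase with their exponents. -/
lemma exists_modNorm_le (d : ℕ) (hp : 1 ≤ p) (hq : 1 ≤ q) (hppt : p ≤ pt) (hqqt : q ≤ qt) :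
    ∃ C : ℝ≥0, ∀ f : SchwartzMap (Ed d) ℂ, modNorm d pt qt f ≤ C * modNorm d p q f := by
  have hpt := hp.trans hppt
  have hqt := hq.trans hqqt
  obtain ⟨u, hu, huv⟩ := exists_exponent (a := 1 + iv pt - iv p)
    (by linarith [iv_le_one hp, iv_nonneg pt]) (by linarith [(iv_le_iv_iff hpt hp).2 hppt])
  obtain ⟨v, hv, hvv⟩ := exists_exponent (a := 1 + iv qt - iv q)
    (by linarith [iv_le_one hq, iv_nonneg qt]) (by linarith [(iv_le_iv_iff hqt hq).2 hqqt])
  have iv_one : iv 1 = 1 := by simp [iv]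
  obtain ⟨K, hK⟩ := exists_enorm_STFT_le_convolution d
  set G₁ : Ed d → ℝ≥0∞ := fun t => ENNReal.ofReal (Real.exp (-(1 / 2) * ‖t‖ ^ 2))
  set G₂ : Ed d → ℝ≥0∞ := fun t => ENNReal.ofReal (Real.exp (-(Real.pi ^ 2 / 2) * ‖t‖ ^ 2))
  have hG₁m : Measurable G₁ := by fun_prop
  have hG₂m : Measurable G₂ := by fun_prop
  lift eNorm volume u G₁ to ℝ≥0 using
    eNorm_exp_neg_mul_sq_norm_ne_top hu (by norm_num) with g₁ hg₁
  lift eNorm volume v G₂ to ℝ≥0 using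
    eNorm_exp_neg_mul_sq_norm_ne_top hv (by positivity) with g₂ hg₂
  have hT₁ : ∀ y : Ed d, MeasurePreserving (fun x => y - x) volume volume :=
    fun y => Measure.measurePreserving_sub_left volume y
  have hT₂ : ∀ x : Ed d, MeasurePreserving (fun y => y - x) volume volume :=
    fun x => measurePreserving_sub_right volume x
  have hT : Measurable (Function.uncurry fun x y : Ed d => y - x) :=
    measurable_snd.sub measurable_fst
  refine ⟨K * g₁ * g₂, fun f => ?_⟩
  set F : Ed d → Ed d → ℝ≥0∞ := fun t ν => ‖STFT d (gauss d) f t ν‖ₑ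
  have hFc : Continuous (Function.uncurry F) := (continuous_STFT f).enorm
  have hFm : ∀ ν, Measurable fun t => F t ν := fun ν => hFc.measurable.of_uncurry_right
  set N : Ed d → ℝ≥0∞ := fun ν => eNorm volume p fun t => F t ν
  have hNm : Measurable N := measurable_eNorm_of_continuous p hFc
  set I : Ed d → Ed d → ℝ≥0∞ := fun t ν => ∫⁻ t', F t' ν * G₁ (t - t')
  have hIm : Measurable (Function.uncurry I) := by
    refine Measurable.lintegral_prod_right'
      (f := fun z : (Ed d × Ed d) × Ed d => F z.2 z.1.2 * G₁ (z.1.1 - z.2)) ?_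
    exact (hFc.measurable.comp (by fun_prop : Measurable fun z : (Ed d × Ed d) × Ed d =>
      (z.2, z.1.2))).mul (hG₁m.comp (by fun_prop))
  have hIN : ∀ ν, eNorm volume pt (fun t => I t ν) ≤ N ν * g₁ := by
    intro ν
    obtain ⟨D, -, hD, hDr⟩ := eNorm_young le_rfl hp hu hpt hp hu (by rw [iv_one]; linarith)
      hT hT₁ hT₂ (hFm ν) hG₁m
    rw [hg₁]
    exact (eNorm_mono fun t => by simpa only [eNorm_one] using hD t).trans hDr
  have hFN : ∀ ν, eNorm volume pt (fun t => F t ν) ≤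
      K * g₁ * ∫⁻ ν', N ν' * G₂ (ν - ν') := by
    intro ν
    have hIν : Measurable fun z : Ed d × Ed d => G₂ (ν - z.2) * I z.1 z.2 :=
      (hG₂m.comp (by fun_prop)).mul hIm
    have hNG : Measurable fun ν' => N ν' * G₂ (ν - ν') :=
      hNm.mul (hG₂m.comp (hT₁ ν).measurable)
    calc eNorm volume pt (fun t => F t ν)
        ≤ eNorm volume pt fun t => K * ∫⁻ ν', G₂ (ν - ν') * I t ν' :=
          eNorm_mono fun t => hK f t ν
      _ = K * eNorm volume pt fun t => ∫⁻ ν', G₂ (ν - ν') * I t ν' :=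
          eNorm_const_mul hpt _ hIν.lintegral_prod_right'
      _ ≤ K * ∫⁻ ν', g₁ * (N ν' * G₂ (ν - ν')) := by
          gcongr
          refine eNorm_lintegral_le hpt hIν (hNG.const_mul _) fun ν' => ?_
          rw [eNorm_const_mul hpt _ (hIm.of_uncurry_right : Measurable fun t => I t ν')]
          calc G₂ (ν - ν') * eNorm volume pt (fun t => I t ν')
              ≤ G₂ (ν - ν') * (N ν' * g₁) := by gcongr; exact hIN ν'
            _ = _ := by ring
      _ = _ := by rw [lintegral_const_mul _ hNG, mul_assoc]
  obtain ⟨D, hDm, hD, hDr⟩ := eNorm_young le_rfl hq hv hqt hq hv (by rw [iv_one]; linarith)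
    hT hT₁ hT₂ hNm hG₂m
  calc modNorm d pt qt f ≤ eNorm volume qt fun ν => K * g₁ * D ν :=
        eNorm_mono fun ν => (hFN ν).trans (by gcongr; simpa only [eNorm_one] using hD ν)
    _ = K * g₁ * eNorm volume qt D := eNorm_const_mul hqt _ hDm
    _ ≤ K * g₁ * (eNorm volume q N * g₂) := by rw [hg₂]; gcongr
    _ = K * g₁ * g₂ * modNorm d p q f := by
        rw [show modNorm d p q f = eNorm volume q N from rfl]
        ring
    _ = _ := by push_cast; rfl

end ModulationSpaces

/-- the key mixed-norm estimate (Proposition `Vtilde` of the paper, `m = 2`,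
trivial weights, identity permutations). -/
theorem stmt8 (d : ℕ) (hd : 1 ≤ d)
    (p₀ p₁ p₂ q₁ q₂ q₃ r₀ r₁ r₂ s₁ s₂ s₃ pt₁ pt₂ qt₁ qt₂ : ℝ≥0∞)
    (hp₀ : 1 ≤ p₀) (hp₁ : 1 ≤ p₁) (hp₂ : 1 ≤ p₂)
    (hq₁ : 1 ≤ q₁) (hq₂ : 1 ≤ q₂) (hq₃ : 1 ≤ q₃)
    (hr₀ : 1 ≤ r₀) (hr₁ : 1 ≤ r₁) (hr₂ : 1 ≤ r₂)
    (hs₁ : 1 ≤ s₁) (hs₂ : 1 ≤ s₂) (hs₃ : 1 ≤ s₃)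
    (hpt₁ : 1 ≤ pt₁) (hpt₂ : 1 ≤ pt₂) (hqt₁ : 1 ≤ qt₁) (hqt₂ : 1 ≤ qt₂)
    (h₁ : p₁ ≤ pt₁) (h₂ : pt₁ ≤ r₁) (h₃ : p₂ ≤ pt₂) (h₄ : pt₂ ≤ r₂)
    (h₅ : q₁ ≤ qt₁) (h₆ : s₁ ≤ qt₁) (h₇ : q₂ ≤ qt₂) (h₈ : s₂ ≤ qt₂)
    (c₁ : iv pt₁ ≤ iv r₀)
    (c₂ : iv pt₁ - iv r₁ ≤ iv r₀ - iv pt₂)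
    (c₃ : iv r₀ - iv p₀ ≤ (iv pt₁ - iv r₁) + (iv pt₂ - iv r₂))
    (c₄ : iv s₃ ≤ iv qt₂)
    (c₅ : iv s₃ - iv qt₁ ≤ iv qt₂ - iv s₂)
    (c₆ : iv s₃ - iv q₃ ≤ (iv qt₁ - iv s₁) + (iv qt₂ - iv s₂)) :
    ∃ C : ℝ≥0, 0 < C ∧
      ∀ f₁ f₂ g : SchwartzMap (Ed d) ℂ,
        eNorm volume s₃ (fun ν => eNorm volume s₂ (fun ξ₂ => eNorm volume s₁ (fun ξ₁ =>
          eNorm volume r₂ (fun t₂ => eNorm volume r₁ (fun t₁ => eNorm volume r₀ (fun x =>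
            (‖STFT d (gauss d) (⇑f₁) (x - t₁) ξ₁‖₊ : ℝ≥0∞) *
              (‖STFT d (gauss d) (⇑f₂) (x - t₂) ξ₂‖₊ : ℝ≥0∞) *
              (‖STFT d (gauss d) (⇑g) x (ν + ξ₁ + ξ₂)‖₊ : ℝ≥0∞)))))))
        ≤ (C : ℝ≥0∞) * modNorm d p₁ q₁ (⇑f₁) * modNorm d p₂ q₂ (⇑f₂) *
            modNorm d p₀ q₃ (⇑g) := by
  obtain ⟨u, hu, huv⟩ := exists_exponent (a := iv r₀ + iv r₁ - iv pt₁)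
    (by linarith [iv_nonneg r₁])
    (by linarith [iv_le_one hr₀, (iv_le_iv_iff hr₁ hpt₁).2 h₂])
  obtain ⟨w, hw, hwv⟩ := exists_exponent (a := iv u + iv r₂ - iv pt₂)
    (by linarith [iv_nonneg r₂])
    (by linarith [iv_le_one hu, (iv_le_iv_iff hr₂ hpt₂).2 h₄])
  obtain ⟨z, hz, hzv⟩ := exists_exponent (a := iv s₂ + iv s₃ - iv qt₂)
    (by linarith [iv_nonneg s₃, (iv_le_iv_iff hqt₂ hs₂).2 h₈])
    (by linarith [iv_le_one hs₂])
  obtain ⟨w', hw', hwv'⟩ := exists_exponent (a := iv s₁ + iv z - iv qt₁)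
    (by linarith [iv_nonneg z, (iv_le_iv_iff hqt₁ hs₁).2 h₆])
    (by linarith [iv_le_one hs₁])
  obtain ⟨C₁, hC₁⟩ := exists_modNorm_le d hp₁ hq₁ h₁ h₅
  obtain ⟨C₂, hC₂⟩ := exists_modNorm_le d hp₂ hq₂ h₃ h₇
  obtain ⟨C₃, hC₃⟩ := exists_modNorm_le (pt := w) (qt := w') d hp₀ hq₃
    ((iv_le_iv_iff hw hp₀).1 (by linarith)) ((iv_le_iv_iff hw' hq₃).1 (by linarith))
  refine ⟨C₁ * C₂ * C₃ + 1, by positivity, fun f₁ f₂ g => ?_⟩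
  let A₁ : Ed d → Ed d → ℝ≥0∞ := fun ξ t => ‖STFT d (gauss d) f₁ t ξ‖₊
  let A₂ : Ed d → Ed d → ℝ≥0∞ := fun ξ t => ‖STFT d (gauss d) f₂ t ξ‖₊
  let A₃ : Ed d → Ed d → ℝ≥0∞ := fun ξ t => ‖STFT d (gauss d) g t ξ‖₊
  have hslice : ∀ (f : SchwartzMap (Ed d) ℂ) (ξ : Ed d),
      Measurable fun t => (‖STFT d (gauss d) f t ξ‖₊ : ℝ≥0∞) := fun f ξ =>
    (((continuous_STFT f).comp (by fun_prop : Continuous fun t : Ed d => (t, ξ))).enorm).measurable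
  have hnorm : ∀ (p : ℝ≥0∞) (f : SchwartzMap (Ed d) ℂ), Measurable fun ξ =>
      eNorm volume p fun t => (‖STFT d (gauss d) f t ξ‖₊ : ℝ≥0∞) := fun p f =>
    measurable_eNorm_of_continuous p (continuous_STFT f).enorm
  have hspace : ∀ ξ₁ ξ₂ ν, eNorm volume r₂ (fun t₂ => eNorm volume r₁ fun t₁ =>
      eNorm volume r₀ fun x => A₁ ξ₁ (x - t₁) * A₂ ξ₂ (x - t₂) * A₃ (ν + ξ₁ + ξ₂) x) ≤
      eNorm volume pt₁ (A₁ ξ₁) * eNorm volume pt₂ (A₂ ξ₂) *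
        eNorm volume w (A₃ (ν + ξ₁ + ξ₂)) := fun ξ₁ ξ₂ ν =>
    eNorm_mul_translates_le hr₀ hr₁ hr₂ hu hw hpt₁ hpt₂
      ((iv_le_iv_iff hu hr₀).1 (by linarith [(iv_le_iv_iff hr₁ hpt₁).2 h₂]))
      ((iv_le_iv_iff hpt₁ hr₀).1 c₁)
      ((iv_le_iv_iff hw hu).1 (by linarith [(iv_le_iv_iff hr₂ hpt₂).2 h₄]))
      ((iv_le_iv_iff hpt₂ hu).1 (by linarith)) (by linarith) (by linarith)
      (hslice f₁ ξ₁) (hslice f₂ ξ₂) (hslice g (ν + ξ₁ + ξ₂))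
  have hfrequency : eNorm volume s₃ (fun ν => eNorm volume s₂ fun ξ₂ => eNorm volume s₁ fun ξ₁ =>
      eNorm volume pt₁ (A₁ ξ₁) * eNorm volume pt₂ (A₂ ξ₂) * eNorm volume w (A₃ (ν + ξ₁ + ξ₂))) ≤
      modNorm d pt₁ qt₁ f₁ * modNorm d pt₂ qt₂ f₂ * modNorm d w w' g :=
    eNorm_mul_sum_le (a := fun ξ => eNorm volume pt₁ (A₁ ξ))
      (b := fun ξ => eNorm volume pt₂ (A₂ ξ)) (c := fun ξ => eNorm volume w (A₃ ξ))
      hs₁ hs₂ hs₃ hz hw' hqt₁ hqt₂ h₆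
      ((iv_le_iv_iff hw' hs₁).1 (by linarith)) h₈
      ((iv_le_iv_iff hz hs₂).1 (by linarith)) (by linarith) (by linarith)
      (hnorm pt₁ f₁) (hnorm pt₂ f₂) (hnorm w g)
  refine (eNorm_mono fun ν => eNorm_mono fun ξ₂ => eNorm_mono fun ξ₁ => hspace ξ₁ ξ₂ ν).trans
    (hfrequency.trans ?_)
  calc modNorm d pt₁ qt₁ f₁ * modNorm d pt₂ qt₂ f₂ * modNorm d w w' g
      ≤ C₁ * modNorm d p₁ q₁ f₁ * (C₂ * modNorm d p₂ q₂ f₂) * (C₃ * modNorm d p₀ q₃ g) := by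
        gcongr
        exacts [hC₁ f₁, hC₂ f₂, hC₃ g]
    _ = ((C₁ * C₂ * C₃ : ℝ≥0) : ℝ≥0∞) * modNorm d p₁ q₁ f₁ * modNorm d p₂ q₂ f₂ *
          modNorm d p₀ q₃ g := by
        push_cast
        ring
    _ ≤ _ := by
        gcongr
        exact le_self_add

end
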